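/- arXiv:2602.13097 — 2 statements merged into one kernel-verified Lean document; each statement's English description precedes it below -/
import Mathlib

section
/- Let G be a finite group of order n ≥ 2 and k a field. Then the partial group algebra k_par G is finite dimensional over k, of dimension dim_k(k_par G) = 2^{n−2}(n+1). -/
open scoped Pointwise

/-- A partial representation of a group `G` on a unital (`k`-)algebra `B`. -/
def IsPartialRep {G B : Type*} [Group G] [Monoid B] (π : G → B) : Prop :=
  π 1 = 1 ∧
  (∀ g h : G, π g * π h * π h⁻¹ = π (g * h) * π h⁻¹) ∧
  (∀ g h : G, π g⁻¹ * π g * π h = π g⁻¹ * π (g * h))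

/-- The defining relations of the partial group algebra. -/
inductive ParRel (k G : Type*) [CommSemiring k] [Group G] :
    FreeAlgebra k G → FreeAlgebra k G → Prop
  | one : ParRel k G (FreeAlgebra.ι k (1 : G)) 1
  | pr2 (g h : G) : ParRel k G
      (FreeAlgebra.ι k g * FreeAlgebra.ι k h * FreeAlgebra.ι k h⁻¹)
      (FreeAlgebra.ι k (g * h) * FreeAlgebra.ι k h⁻¹)
  | pr3 (g h : G) : ParRel k G
      (FreeAlgebra.ι k g⁻¹ * FreeAlgebra.ι k g * FreeAlgebra.ι k h)
      (FreeAlgebra.ι k g⁻¹ * FreeAlgebra.ι k (g * h))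

/-- The partial group algebra `k_par G`. -/
abbrev ParAlg (k G : Type*) [CommSemiring k] [Group G] := RingQuot (ParRel k G)

/-- The generator `[g]` of the partial group algebra. -/
noncomputable def parGen (k : Type*) {G : Type*} [CommSemiring k] [Group G] (g : G) :
    ParAlg k G :=
  RingQuot.mkAlgHom k (ParRel k G) (FreeAlgebra.ι k g)

/-- The idempotent `P_X = (∏_{r ∈ X} ε_r)·(∏_{s ∉ X} (1 - ε_s))`, where `ε_g = π(g)π(g⁻¹)`. -/
noncomputable def parP {G B : Type*} [Group G] [Fintype G] [DecidableEq G] [Ring B]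
    (π : G → B) (X : Finset G) : B :=
  (X.toList.map fun r => π r * π r⁻¹).prod *
    (Xᶜ.toList.map fun s => 1 - π s * π s⁻¹).prod

/-- `Γ_X = Σ_{Y ∼ X} P_Y`, where `Y ∼ X` iff `Y = gX` for some `g ∈ G`. -/
noncomputable def parGamma {G B : Type*} [Group G] [Fintype G] [DecidableEq G] [Ring B]
    (π : G → B) (X : Finset G) : B :=
  ∑ Y ∈ Finset.univ.filter (fun Y : Finset G => ∃ g : G, Y = g • X), parP π Y

namespace IsPartialRep

variable {G B : Type*} [Group G] [Monoid B] {π : G → B}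

theorem mul_eq (hπ : IsPartialRep π) (g h : G) : π g * π h = π g * π g⁻¹ * π (g * h) := by
  have := hπ.2.2 g⁻¹ (g * h)
  rw [inv_inv, inv_mul_cancel_left] at this
  exact this.symm

theorem mul_inv_mul (hπ : IsPartialRep π) (g : G) : π g * π g⁻¹ * π g = π g := by
  have := hπ.2.1 g g⁻¹
  rwa [inv_inv, mul_inv_cancel, hπ.1, one_mul] at this

theorem isIdempotentElem (hπ : IsPartialRep π) (g : G) : IsIdempotentElem (π g * π g⁻¹) := by
  rw [IsIdempotentElem, ← mul_assoc, hπ.mul_inv_mul]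

theorem mul_idempotent (hπ : IsPartialRep π) (g h : G) :
    π g * (π h * π h⁻¹) = π (g * h) * π (g * h)⁻¹ * π g := by
  have h3 := hπ.2.2 (g * h)⁻¹ g
  rw [inv_inv, show (g * h)⁻¹ * g = h⁻¹ by group] at h3
  rw [h3, ← mul_assoc, hπ.2.1]

theorem commute (hπ : IsPartialRep π) (g h : G) :
    Commute (π g * π g⁻¹) (π h * π h⁻¹) := by
  rw [Commute, SemiconjBy, mul_assoc, hπ.mul_idempotent, ← mul_assoc, hπ.mul_idempotent,
    mul_inv_cancel_left, mul_assoc]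

/-- The product of the idempotents `π a * π a⁻¹` over `a ∈ A`. -/
noncomputable def idemProd (hπ : IsPartialRep π) (A : Finset G) : B :=
  A.noncommProd (fun a => π a * π a⁻¹) fun a _ b _ _ => hπ.commute a b

@[simp]
theorem idemProd_empty (hπ : IsPartialRep π) : hπ.idemProd ∅ = 1 :=
  Finset.noncommProd_empty _ _

theorem idemProd_insert [DecidableEq G] (hπ : IsPartialRep π) (a : G) (A : Finset G) :
    hπ.idemProd (insert a A) = π a * π a⁻¹ * hπ.idemProd A := by
  have key (A : Finset G) (ha : a ∉ A) :
      hπ.idemProd (insert a A) = π a * π a⁻¹ * hπ.idemProd A :=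
    Finset.noncommProd_insert_of_notMem _ _ _ _ ha
  by_cases ha : a ∈ A
  · rw [Finset.insert_eq_of_mem ha, ← Finset.insert_erase ha, key _ (Finset.notMem_erase a A),
      ← mul_assoc, (hπ.isIdempotentElem a).eq]
  · exact key A ha

theorem idemProd_insert_one [DecidableEq G] (hπ : IsPartialRep π) (A : Finset G) :
    hπ.idemProd (insert 1 A) = hπ.idemProd A := by
  rw [idemProd_insert, inv_one, hπ.1, one_mul, one_mul]

theorem mul_idemProd [DecidableEq G] (hπ : IsPartialRep π) (g : G) (A : Finset G) :
    π g * hπ.idemProd A = hπ.idemProd (g • A) * π g := by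
  induction A using Finset.induction_on with
  | empty => simp
  | insert a A _ ih =>
    rw [Finset.smul_finset_insert, idemProd_insert, idemProd_insert, ← mul_assoc,
      hπ.mul_idempotent, mul_assoc, ih, smul_eq_mul, mul_assoc, mul_assoc, mul_assoc]

theorem idemProd_mul_self [DecidableEq G] (hπ : IsPartialRep π) {a : G} {A : Finset G}
    (ha : a ∈ A) : hπ.idemProd A * (π a * π a⁻¹) = hπ.idemProd A := by
  have hc : Commute (π a * π a⁻¹) (hπ.idemProd A) :=
    Finset.noncommProd_commute _ _ _ _ fun b _ => hπ.commute a b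
  rw [← hc.eq, ← idemProd_insert, Finset.insert_eq_of_mem ha]

end IsPartialRep

theorem isPartialRep_parGen (k G : Type*) [CommSemiring k] [Group G] :
    IsPartialRep (parGen k : G → ParAlg k G) := by
  refine ⟨?_, fun g h => ?_, fun g h => ?_⟩
  · simpa [parGen] using RingQuot.mkAlgHom_rel k (ParRel.one (k := k) (G := G))
  · simpa [parGen] using RingQuot.mkAlgHom_rel k (ParRel.pr2 (k := k) g h)
  · simpa [parGen] using RingQuot.mkAlgHom_rel k (ParRel.pr3 (k := k) g h)

namespace ParAlg

/-- The algebra homomorphism out of `ParAlg k G` induced by a partial representation. -/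
noncomputable def lift {k G B : Type*} [CommSemiring k] [Group G] [Semiring B] [Algebra k B]
    {π : G → B} (hπ : IsPartialRep π) : ParAlg k G →ₐ[k] B :=
  RingQuot.liftAlgHom k ⟨FreeAlgebra.lift k π, fun x y hxy => by
    cases hxy with
    | one => simpa using hπ.1
    | pr2 g h => simpa using hπ.2.1 g h
    | pr3 g h => simpa using hπ.2.2 g h⟩

@[simp]
theorem lift_parGen {k G B : Type*} [CommSemiring k] [Group G] [Semiring B] [Algebra k B]
    {π : G → B} (hπ : IsPartialRep π) (g : G) : lift (k := k) hπ (parGen k g) = π g := by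
  simp [lift, parGen]

theorem induction {k G : Type*} [CommSemiring k] [Group G] {p : ParAlg k G → Prop}
    (algebraMap : ∀ c : k, p (algebraMap k (ParAlg k G) c)) (parGen : ∀ g : G, p (parGen k g))
    (mul : ∀ x y, p x → p y → p (x * y)) (add : ∀ x y, p x → p y → p (x + y))
    (x : ParAlg k G) : p x := by
  obtain ⟨x, rfl⟩ := RingQuot.mkAlgHom_surjective k (ParRel k G) x
  induction x using FreeAlgebra.induction with
  | grade0 c => simpa using algebraMap c
  | grade1 g => exact parGen g
  | mul x y hx hy => simpa using mul _ _ hx hy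
  | add x y hx hy => simpa using add _ _ hx hy

end ParAlg

/-- The underlying set of Exel's semigroup of `G`: pairs `(A, g)` with `1, g ∈ A`. -/
abbrev Exel (G : Type*) [Group G] := {p : Finset G × G // 1 ∈ p.1 ∧ p.2 ∈ p.1}

namespace Exel

section

variable {G : Type*} [Group G] [DecidableEq G]

/-- Left multiplication by the generator `({1, g}, g)` of Exel's semigroup. -/
def act (g : G) (s : Exel G) : Exel G :=
  ⟨(insert 1 (g • s.1.1), g * s.1.2),
    Finset.mem_insert_self _ _,
    Finset.mem_insert_of_mem (Finset.smul_mem_smul_finset s.2.2)⟩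

/-- The identity element `({1}, 1)` of Exel's semigroup. -/
def unit : Exel G := ⟨({1}, 1), by simp⟩

theorem act_one (s : Exel G) : act 1 s = s := by
  obtain ⟨⟨A, x⟩, h1, hx⟩ := s
  apply Subtype.ext
  simp_all [act]

theorem act_act_inv (g : G) (s : Exel G) :
    (act g (act g⁻¹ s)).1 = (insert g s.1.1, s.1.2) := by
  obtain ⟨⟨A, x⟩, h1, hx⟩ := s
  dsimp only at h1
  simp [act, Finset.smul_finset_insert, Finset.insert_comm 1 g, Finset.insert_eq_of_mem h1]

theorem act_act_act_inv (g h : G) (s : Exel G) :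
    act g (act h (act h⁻¹ s)) = act (g * h) (act h⁻¹ s) := by
  obtain ⟨⟨A, x⟩, h1, hx⟩ := s
  have hg : g ∈ g • A := by simpa using Finset.smul_mem_smul_finset (a := g) h1
  apply Subtype.ext
  simp [act, Finset.smul_finset_insert, smul_smul, mul_assoc, hg]

theorem act_inv_act_act (g h : G) (s : Exel G) :
    act g⁻¹ (act g (act h s)) = act g⁻¹ (act (g * h) s) := by
  obtain ⟨⟨A, x⟩, h1, hx⟩ := s
  apply Subtype.ext
  simp [act, Finset.smul_finset_insert, smul_smul, mul_assoc, Finset.insert_comm 1 g⁻¹]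

theorem isPartialRep_lmapDomain (k : Type*) [CommSemiring k] :
    IsPartialRep (fun g : G => (Finsupp.lmapDomain k k (act g) : Module.End k (Exel G →₀ k))) := by
  refine ⟨?_, fun g h => ?_, fun g h => ?_⟩
  all_goals
    ext s : 1
    ext
    simp [Finsupp.mapDomain_single, act_one, act_act_act_inv, act_inv_act_act]

/-- The linear map sending `(A, g)` to `(∏ a ∈ A, [a][a⁻¹]) * [g]`. -/
noncomputable def toParAlg (k : Type*) [CommSemiring k] : (Exel G →₀ k) →ₗ[k] ParAlg k G :=
  Finsupp.linearCombination k fun s =>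
    (isPartialRep_parGen k G).idemProd s.1.1 * parGen k s.1.2

theorem toParAlg_lift (k : Type*) [CommSemiring k] (x : ParAlg k G) (v : Exel G →₀ k) :
    toParAlg k (ParAlg.lift (isPartialRep_lmapDomain k) x v) = x * toParAlg k v := by
  induction x using ParAlg.induction generalizing v with
  | algebraMap c => simp [Module.algebraMap_end_apply, Algebra.smul_def]
  | mul x y hx hy => rw [map_mul, Module.End.mul_apply, hx, hy, mul_assoc]
  | add x y hx hy => rw [map_add, LinearMap.add_apply, map_add, hx, hy, add_mul]
  | parGen g =>
    induction v using Finsupp.induction_linear with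
    | zero => simp
    | add v w hv hw => rw [map_add, map_add, map_add, hv, hw, mul_add]
    | single s c =>
      have hg : g ∈ g • s.1.1 := by simpa using Finset.smul_mem_smul_finset (a := g) s.2.1
      have hπ := isPartialRep_parGen k G
      simp only [ParAlg.lift_parGen, Finsupp.lmapDomain_apply, Finsupp.mapDomain_single, toParAlg,
        Finsupp.linearCombination_single, act, mul_smul_comm]
      rw [hπ.idemProd_insert_one, ← mul_assoc, hπ.mul_idemProd, mul_assoc, hπ.mul_eq, ← mul_assoc,
        hπ.idemProd_mul_self hg]

theorem lift_idemProd_single (k : Type*) [CommSemiring k] (A : Finset G) (s : Exel G) :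
    ∃ t : Exel G, t.1 = (A ∪ s.1.1, s.1.2) ∧
      ParAlg.lift (isPartialRep_lmapDomain k) ((isPartialRep_parGen k G).idemProd A)
        (Finsupp.single s 1) = Finsupp.single t 1 := by
  induction A using Finset.induction_on with
  | empty => exact ⟨s, by simp, by simp⟩
  | insert a A _ ih =>
    obtain ⟨t, ht, h⟩ := ih
    refine ⟨act a (act a⁻¹ t), by rw [act_act_inv, ht, Finset.insert_union], ?_⟩
    rw [IsPartialRep.idemProd_insert, map_mul, Module.End.mul_apply, h]
    simp [Finsupp.mapDomain_single]

theorem lift_toParAlg_single (k : Type*) [CommSemiring k] (s : Exel G) :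
    ParAlg.lift (isPartialRep_lmapDomain k) (toParAlg k (Finsupp.single s 1))
      (Finsupp.single unit 1) = Finsupp.single s 1 := by
  obtain ⟨t, ht, h⟩ := lift_idemProd_single k s.1.1 (act s.1.2 unit)
  have hts : t = s := by
    obtain ⟨⟨A, x⟩, h1, hx⟩ := s
    apply Subtype.ext
    rw [ht]
    simp_all [act, unit]
  rw [hts] at h
  simpa [toParAlg, Finsupp.mapDomain_single] using h

/-- The partial group algebra is free on Exel's semigroup. -/
noncomputable def equivParAlg (k : Type*) [CommSemiring k] : (Exel G →₀ k) ≃ₗ[k] ParAlg k G :=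
  LinearEquiv.ofLinearMap (toParAlg k)
    ((LinearMap.applyₗ (Finsupp.single unit 1)).comp
      (ParAlg.lift (isPartialRep_lmapDomain k)).toLinearMap)
    (by
      have hπ := isPartialRep_parGen k G
      have hunit : toParAlg k (Finsupp.single (unit : Exel G) 1) = 1 := by
        simpa [toParAlg, unit, hπ.1] using hπ.idemProd_insert_one ∅
      ext1 x
      simp [toParAlg_lift, hunit])
    (by
      ext1 s
      ext1
      simpa using lift_toParAlg_single k s)

end

theorem card_eq (G : Type*) [Group G] [Fintype G] [DecidableEq G] (hcard : 2 ≤ Fintype.card G) :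
    Fintype.card (Exel G) = 2 ^ (Fintype.card G - 2) * (Fintype.card G + 1) := by
  let e : Exel G ≃ Σ g : G, Finset.Icc {1, g} (Finset.univ : Finset G) :=
    { toFun s := ⟨s.1.2, s.1.1, by
        simpa [Finset.insert_subset_iff] using s.2⟩
      invFun t := ⟨(t.2.1, t.1), by
        simpa [Finset.insert_subset_iff] using (Finset.mem_Icc.1 t.2.2).1⟩
      left_inv _ := rfl
      right_inv _ := rfl }
  have h (g : G) (hg : g ∈ Finset.univ.erase 1) :
      2 ^ (Fintype.card G - Finset.card {1, g}) = 2 ^ (Fintype.card G - 2) := by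
    rw [Finset.card_pair (Finset.ne_of_mem_erase hg).symm]
  rw [Fintype.card_congr e, Fintype.card_sigma]
  simp only [Fintype.card_coe, Finset.card_Icc_finset (Finset.subset_univ _), Finset.card_univ]
  rw [← Finset.add_sum_erase _ _ (Finset.mem_univ 1), Finset.sum_congr rfl h]
  obtain ⟨m, hm⟩ := Nat.exists_eq_add_of_le hcard
  simp only [Finset.pair_eq_singleton, Finset.card_singleton, Finset.sum_const, smul_eq_mul,
    Finset.card_erase_of_mem (Finset.mem_univ _), Finset.card_univ, hm]
  rw [show 2 + m - 1 = m + 1 by omega, show 2 + m - 2 = m by omega]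
  ring

end Exel

/-- For a finite group `G` of order `n ≥ 2`, the partial group algebra `k_par G` is
finite dimensional over `k` of dimension `2^(n-2)·(n+1)`. -/
theorem parAlg_finrank
    (k : Type*) [Field k] (G : Type*) [Group G] [Fintype G]
    (hcard : 2 ≤ Fintype.card G) :
    FiniteDimensional k (ParAlg k G) ∧
      Module.finrank k (ParAlg k G) =
        2 ^ (Fintype.card G - 2) * (Fintype.card G + 1) := by
  classical
  let e : (Exel G →₀ k) ≃ₗ[k] ParAlg k G := Exel.equivParAlg k
  refine ⟨Module.Finite.equiv e, ?_⟩
  rw [← e.finrank_eq, Module.finrank_finsupp_self, Exel.card_eq G hcard]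
end

section
/- Centrality of Γ_X: let G be a finite group and π : G → B a partial representation on a unital associative k-algebra B. Then for every g ∈ G and every subset X ⊆ G with e ∈ X, one has π(g) Γ_X = Γ_X π(g). -/
open scoped Pointwise

namespace IsPartialRep

variable {G B : Type*} [Group G]

/-- The intertwining relation `π(g) ε_h = ε_{gh} π(g)`. -/
theorem mul_idem [Monoid B] {π : G → B} (hπ : IsPartialRep π) (g h : G) :
    π g * (π h * π h⁻¹) = π (g * h) * π (g * h)⁻¹ * π g := by
  have h3 := hπ.2.2 (g * h)⁻¹ g
  rw [inv_inv, show (g * h)⁻¹ * g = h⁻¹ by group] at h3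
  rw [h3, ← mul_assoc, hπ.2.1]

/-- The elements `ε_g` commute pairwise. -/
theorem commute_idem [Monoid B] {π : G → B} (hπ : IsPartialRep π) (g h : G) :
    Commute (π g * π g⁻¹) (π h * π h⁻¹) := by
  rw [Commute, SemiconjBy, mul_assoc, hπ.mul_idem, ← mul_assoc, hπ.mul_idem]
  simp only [mul_inv_cancel_left, mul_assoc]

end IsPartialRep

/-- An element intertwining a commuting family with its translate intertwines products. -/
theorem mul_prod_toList_smul {G B : Type*} [Group G] [DecidableEq G] [Monoid B]
    {f : G → B} (hf : ∀ x y, Commute (f x) (f y)) {g : G} {a : B}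
    (ha : ∀ x, a * f x = f (g * x) * a) (Y : Finset G) :
    a * (Y.toList.map f).prod = ((g • Y).toList.map f).prod * a := by
  have hperm : (g • Y).toList.Perm (Y.toList.map (g * ·)) := by
    refine (List.perm_ext_iff_of_nodup (Finset.nodup_toList _)
      ((Finset.nodup_toList _).map (mul_right_injective g))).2 fun x => ?_
    simp [Finset.mem_smul_finset]
  have hprod : ((g • Y).toList.map f).prod = ((Y.toList.map (g * ·)).map f).prod :=
    (hperm.map f).prod_eq' (List.pairwise_map.2 (List.pairwise_of_forall fun x y => hf _ _))
  rw [hprod]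
  induction Y.toList with
  | nil => simp
  | cons x l ih =>
    simp only [List.map_cons, List.prod_cons]
    rw [← mul_assoc, ha, mul_assoc, ih, mul_assoc]

theorem IsPartialRep.mul_parP {G B : Type*} [Group G] [Fintype G] [DecidableEq G] [Ring B]
    {π : G → B} (hπ : IsPartialRep π) (g : G) (Y : Finset G) :
    π g * parP π Y = parP π (g • Y) * π g := by
  have hcompl : (g • Y)ᶜ = g • Yᶜ := by
    ext x
    simp [← Finset.inv_smul_mem_iff]
  rw [parP, parP, hcompl, ← mul_assoc,
    mul_prod_toList_smul hπ.commute_idem (hπ.mul_idem g), mul_assoc,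
    mul_prod_toList_smul (f := fun s => 1 - π s * π s⁻¹) (g := g), mul_assoc]
  · intro x y
    exact ((Commute.one_left _).sub_left
      ((Commute.one_right _).sub_right (hπ.commute_idem x y)))
  · intro x
    rw [mul_sub, sub_mul, hπ.mul_idem, mul_one, one_mul]

/-- **Centrality of `Γ_X`.** For a finite group `G`, a partial representation
`π : G → B`, every `g ∈ G` and every `X ⊆ G` with `e ∈ X`:
`π(g) Γ_X = Γ_X π(g)`. -/
theorem parGamma_central
    (k : Type*) [Field k] {G : Type*} [Group G] [Fintype G] [DecidableEq G]
    {B : Type*} [Ring B] [Algebra k B]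
    (π : G → B) (hπ : IsPartialRep π) (g : G) (X : Finset G) (hX : (1 : G) ∈ X) :
    π g * parGamma π X = parGamma π X * π g := by
  rw [parGamma, Finset.mul_sum, Finset.sum_mul]
  refine Finset.sum_equiv (MulAction.toPerm g) (fun Y => ?_) fun Y _ => hπ.mul_parP g Y
  simp only [Finset.mem_filter, Finset.mem_univ, true_and, MulAction.toPerm_apply]
  constructor
  · rintro ⟨h, rfl⟩
    exact ⟨g * h, smul_smul g h X⟩
  · rintro ⟨h, hh⟩
    exact ⟨g⁻¹ * h, by rw [mul_smul, ← hh, inv_smul_smul]⟩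
end
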